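/- arXiv:1201.2242 — 2 statements merged into one kernel-verified Lean document; each statement's English description precedes it below -/
import Mathlib

section
/- (Stopping criterion for homogeneous ideals.) Let I be an ideal of MvPolynomial (Fin n) k generated by finitely many nonzero homogeneous polynomials, each of total degree at most d, and let C be the set of g-corners of I of total degree at most d. If not every g-corner of I has total degree at most d, then there exists a g-corner μ of I with d < |μ| and |μ| ≤ max over pairs a, b ∈ C of |a ⊔ b|, where a ⊔ b is the componentwise maximum (the exponent of lcm(x^a, x^b)); in particular |μ| ≤ 2d. -/
/-- `β` is the local lead exponent `ll f` of a nonzero polynomial `f` with respect to the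
monomial order `m`: it belongs to the support of `f` and is `m`-minimal there. -/
def isLocalLead {k : Type*} [Field k] {n : ℕ} (m : MonomialOrder (Fin n))
    (f : MvPolynomial (Fin n) k) (β : Fin n →₀ ℕ) : Prop :=
  β ∈ f.support ∧ ∀ γ ∈ f.support, m.toSyn β ≤ m.toSyn γ

/-- `α` lies in the initial ideal of `I`: some nonzero `f ∈ I` has `ll f ≤ α` componentwise. -/
def memInitial {k : Type*} [Field k] {n : ℕ} (m : MonomialOrder (Fin n))
    (I : Ideal (MvPolynomial (Fin n) k)) (α : Fin n →₀ ℕ) : Prop :=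
  ∃ f ∈ I, f ≠ 0 ∧ ∃ β, isLocalLead m f β ∧ β ≤ α

/-- A g-corner of `I`: an exponent in the initial ideal of `I`, minimal under componentwise `≤`. -/
def isGCorner {k : Type*} [Field k] {n : ℕ} (m : MonomialOrder (Fin n))
    (I : Ideal (MvPolynomial (Fin n) k)) (μ : Fin n →₀ ℕ) : Prop :=
  memInitial m I μ ∧ ∀ ν, memInitial m I ν → ν ≤ μ → ν = μ

open MvPolynomial

section StoppingCriterion

variable {k : Type*} [Field k] {n : ℕ}

/-- `f` has local lead exponent `β` with coefficient `1`. -/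
def isMonicLocalLead (m : MonomialOrder (Fin n)) (f : MvPolynomial (Fin n) k)
    (β : Fin n →₀ ℕ) : Prop :=
  coeff β f = 1 ∧ ∀ γ ∈ f.support, m.toSyn β ≤ m.toSyn γ

/-- The monomial multiples of the polynomials `g c`, `c ∈ C`, whose exponent `γ + c` has degree `e`
and lies in `A`. -/
def monomialMultiples (C : Set (Fin n →₀ ℕ)) (g : (Fin n →₀ ℕ) → MvPolynomial (Fin n) k)
    (e : ℕ) (A : Set (Fin n →₀ ℕ)) : Set (MvPolynomial (Fin n) k) :=
  {p | ∃ γ, ∃ c ∈ C, Finsupp.degree (γ + c) = e ∧ γ + c ∈ A ∧ p = monomial γ 1 * g c}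

theorem exists_isLocalLead (m : MonomialOrder (Fin n)) {f : MvPolynomial (Fin n) k}
    (hf : f ≠ 0) : ∃ β, isLocalLead m f β :=
  f.support.exists_min_image m.toSyn (support_nonempty.mpr hf)

theorem MvPolynomial.IsHomogeneous.degree_eq_of_mem_support {f : MvPolynomial (Fin n) k} {e : ℕ}
    (hf : f.IsHomogeneous e) {β : Fin n →₀ ℕ} (hβ : β ∈ f.support) : Finsupp.degree β = e := by
  by_contra h
  exact mem_support_iff.mp hβ (hf.coeff_eq_zero h)

theorem exists_of_mem_support_monomial_mul {γ : Fin n →₀ ℕ} {a : k}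
    {f : MvPolynomial (Fin n) k} {β : Fin n →₀ ℕ} (hβ : β ∈ (monomial γ a * f).support) :
    ∃ δ ∈ f.support, β = γ + δ := by
  rw [mem_support_iff, coeff_monomial_mul'] at hβ
  split_ifs at hβ with h
  · exact ⟨β - γ, mem_support_iff.mpr (right_ne_zero_of_mul hβ), (add_tsub_cancel_of_le h).symm⟩
  · exact absurd rfl hβ

theorem isMonicLocalLead.monomial_mul {m : MonomialOrder (Fin n)} {f : MvPolynomial (Fin n) k}
    {β : Fin n →₀ ℕ} (hf : isMonicLocalLead m f β) (γ : Fin n →₀ ℕ) :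
    isMonicLocalLead m (monomial γ 1 * f) (γ + β) := by
  refine ⟨by rw [coeff_monomial_mul, hf.1, mul_one], fun δ hδ ↦ ?_⟩
  obtain ⟨δ, hδ', rfl⟩ := exists_of_mem_support_monomial_mul hδ
  rw [map_add, map_add]
  exact add_le_add_right (hf.2 δ hδ') _

/-- Cancelling the coefficient at a monic local lead leaves only larger exponents. -/
theorem isMonicLocalLead.lt_of_mem_support_sub {m : MonomialOrder (Fin n)}
    {f h : MvPolynomial (Fin n) k} {α : Fin n →₀ ℕ} (hf : isMonicLocalLead m f α)
    (hh : ∀ γ ∈ h.support, m.toSyn α ≤ m.toSyn γ) :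
    ∀ γ ∈ (h - C (coeff α h) * f).support, m.toSyn α < m.toSyn γ := by
  intro γ hγ
  have hne : α ≠ γ := by
    rintro rfl
    rw [mem_support_iff, coeff_sub, coeff_C_mul, hf.1, mul_one, sub_self] at hγ
    exact hγ rfl
  refine lt_of_le_of_ne ?_ fun heq ↦ hne (m.toSyn.injective heq)
  rcases Finset.mem_union.mp (support_sub (Fin n) _ _ hγ) with hγ | hγ
  · exact hh γ hγ
  · rw [← smul_eq_C_mul] at hγ
    exact hf.2 γ (support_smul hγ)

/-- Descending induction along a monomial order among the exponents of degree `e`. -/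
theorem descending_induction (m : MonomialOrder (Fin n)) (e : ℕ) {P : (Fin n →₀ ℕ) → Prop}
    (step : ∀ α, Finsupp.degree α = e →
      (∀ β, Finsupp.degree β = e → m.toSyn α < m.toSyn β → P β) → P α)
    (α : Fin n →₀ ℕ) (hα : Finsupp.degree α = e) : P α := by
  by_contra hP
  obtain ⟨β, ⟨hβ, hPβ⟩, hmax⟩ := Set.exists_max_image
    {α : Fin n →₀ ℕ | Finsupp.degree α = e ∧ ¬ P α} m.toSyn
    ((Finsupp.finite_of_degree_eq e).subset fun _ h ↦ h.1) ⟨α, hα, hP⟩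
  refine hPβ (step β hβ fun γ hγ hlt ↦ ?_)
  by_contra hPγ
  exact absurd (hmax γ ⟨hγ, hPγ⟩) (not_le.mpr hlt)

theorem monomial_mul_mem_span_monomialMultiples {S : Set (Fin n →₀ ℕ)}
    {g : (Fin n →₀ ℕ) → MvPolynomial (Fin n) k} {e : ℕ} {A B : Set (Fin n →₀ ℕ)}
    {p : MvPolynomial (Fin n) k} (hp : p ∈ Submodule.span k (monomialMultiples S g e A))
    (u : Fin n →₀ ℕ) (a : k) (hAB : ∀ β ∈ A, u + β ∈ B) :
    monomial u a * p ∈ Submodule.span k (monomialMultiples S g (Finsupp.degree u + e) B) := by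
  induction hp using Submodule.span_induction with
  | mem p hp =>
    obtain ⟨γ, c, hc, hdeg, hA, rfl⟩ := hp
    have : monomial u a * (monomial γ 1 * g c) = a • (monomial (u + γ) 1 * g c) := by
      rw [← mul_assoc, monomial_mul, mul_one, ← smul_mul_assoc, smul_monomial, smul_eq_mul, mul_one]
    rw [this]
    refine Submodule.smul_mem _ _ (Submodule.subset_span ⟨u + γ, c, hc, ?_, ?_, rfl⟩)
    · rw [add_assoc, map_add, hdeg]
    · rw [add_assoc]
      exact hAB _ hA
  | zero => simp
  | add x y _ _ hx hy => rw [mul_add]; exact add_mem hx hy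
  | smul t x _ hx => rw [mul_smul_comm]; exact Submodule.smul_mem _ _ hx

/-- Reduction in degree `e`: if every local lead exponent of a homogeneous element of `I` of
degree `e` is a multiple of an element of `S`, then each such element is a combination of monomial
multiples of the `g c` that involves no exponents below its own local lead exponent. -/
theorem mem_span_monomialMultiples {m : MonomialOrder (Fin n)}
    {I : Ideal (MvPolynomial (Fin n) k)} {S : Set (Fin n →₀ ℕ)}
    {g : (Fin n →₀ ℕ) → MvPolynomial (Fin n) k}
    (hgI : ∀ c ∈ S, g c ∈ I) (hghom : ∀ c ∈ S, (g c).IsHomogeneous (Finsupp.degree c))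
    (hglead : ∀ c ∈ S, isMonicLocalLead m (g c) c) {e : ℕ}
    (hcover : ∀ h ∈ I, h.IsHomogeneous e → ∀ α, isLocalLead m h α → ∃ c ∈ S, c ≤ α)
    {A : Set (Fin n →₀ ℕ)} {h : MvPolynomial (Fin n) k} (hI : h ∈ I) (hhom : h.IsHomogeneous e)
    (hA : ∀ β ∈ h.support, ∀ γ, m.toSyn β ≤ m.toSyn γ → γ ∈ A) :
    h ∈ Submodule.span k (monomialMultiples S g e A) := by
  rcases eq_or_ne h 0 with rfl | h0
  · exact zero_mem _
  obtain ⟨α, hα⟩ := exists_isLocalLead m h0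
  refine descending_induction m e (P := fun α ↦ ∀ h ∈ I, h.IsHomogeneous e → isLocalLead m h α →
    (∀ γ, m.toSyn α ≤ m.toSyn γ → γ ∈ A) → h ∈ Submodule.span k (monomialMultiples S g e A))
    ?_ α (hhom.degree_eq_of_mem_support hα.1) h hI hhom hα (hA α hα.1)
  clear! h α
  intro α hαe ih h hI hhom hα hA
  obtain ⟨c, hc, hle⟩ := hcover h hI hhom α hα
  have hadd : α - c + c = α := tsub_add_cancel_of_le hle
  have hlead := (hglead c hc).monomial_mul (α - c)
  rw [hadd] at hlead
  have hlt := hlead.lt_of_mem_support_sub hα.2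
  have hmem : monomial (α - c) 1 * g c ∈ monomialMultiples S g e A :=
    ⟨α - c, c, hc, by rw [hadd, hαe], by rw [hadd]; exact hA α le_rfl, rfl⟩
  have hxhom : (monomial (α - c) 1 * g c).IsHomogeneous e := by
    have := (isHomogeneous_monomial (1 : k) (rfl : Finsupp.degree (α - c) = _)).mul (hghom c hc)
    rwa [← map_add, hadd, hαe] at this
  rw [← sub_add_cancel h (C (coeff α h) * (monomial (α - c) 1 * g c))]
  refine add_mem ?_ ?_
  · set h' := h - C (coeff α h) * (monomial (α - c) 1 * g c)
    rcases eq_or_ne h' 0 with h0 | h0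
    · rw [h0]; exact zero_mem _
    obtain ⟨β, hβ⟩ := exists_isLocalLead m h0
    have hhom' : h'.IsHomogeneous e := hhom.sub (hxhom.C_mul _)
    exact ih β (hhom'.degree_eq_of_mem_support hβ.1) (hlt β hβ.1) h'
      (I.sub_mem hI (I.mul_mem_left _ (I.mul_mem_left _ (hgI c hc)))) hhom' hβ
      fun γ hγ ↦ hA γ ((hlt β hβ.1).le.trans hγ)
  · rw [← smul_eq_C_mul]
    exact Submodule.smul_mem _ _ (Submodule.subset_span hmem)

theorem mem_span_monomialMultiples_of_generators {S : Set (Fin n →₀ ℕ)}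
    {g : (Fin n →₀ ℕ) → MvPolynomial (Fin n) k} {ι : Type*} [Fintype ι]
    {f : ι → MvPolynomial (Fin n) k} {δ : ι → ℕ} (hf : ∀ i, (f i).IsHomogeneous (δ i))
    (hfspan : ∀ i, f i ∈ Submodule.span k (monomialMultiples S g (δ i) Set.univ)) {e : ℕ}
    {h : MvPolynomial (Fin n) k} (hI : h ∈ Ideal.span (Set.range f)) (hhom : h.IsHomogeneous e) :
    h ∈ Submodule.span k (monomialMultiples S g e Set.univ) := by
  have key : ∀ i p, homogeneousComponent e (p * f i) ∈
      Submodule.span k (monomialMultiples S g e Set.univ) := by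
    intro i p
    induction p using MvPolynomial.induction_on' with
    | monomial u a =>
      have := (isHomogeneous_monomial a (rfl : Finsupp.degree u = _)).mul (hf i)
      rw [homogeneousComponent_of_mem ((mem_homogeneousSubmodule _ _).mpr this)]
      split_ifs with he
      · rw [he]
        exact monomial_mul_mem_span_monomialMultiples (hfspan i) u a fun _ _ ↦ Set.mem_univ _
      · exact zero_mem _
    | add p q hp hq => rw [add_mul, map_add]; exact add_mem hp hq
  obtain ⟨p, rfl⟩ := Ideal.mem_span_range_iff_exists_fun.mp hI
  have := homogeneousComponent_of_mem (m := e) ((mem_homogeneousSubmodule _ _).mpr hhom)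
  rw [if_pos rfl, map_sum] at this
  rw [← this]
  exact sum_mem fun i _ ↦ key i (p i)

/-- A combination of polynomials with distinct monic local leads has its local lead among them. -/
theorem isLocalLead.mem_of_mem_span {m : MonomialOrder (Fin n)} {M : Set (Fin n →₀ ℕ)}
    {b : (Fin n →₀ ℕ) → MvPolynomial (Fin n) k} (hb : ∀ α ∈ M, isMonicLocalLead m (b α) α)
    {h : MvPolynomial (Fin n) k} (hspan : h ∈ Submodule.span k (b '' M)) {α : Fin n →₀ ℕ}
    (hα : isLocalLead m h α) : α ∈ M := by
  obtain ⟨l, hl, rfl⟩ := (Finsupp.mem_span_image_iff_linearCombination k).mp hspan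
  rw [Finsupp.mem_supported] at hl
  have hcoeff : ∀ γ, coeff γ (Finsupp.linearCombination k b l) =
      ∑ τ ∈ l.support, l τ * coeff γ (b τ) := by
    intro γ
    rw [Finsupp.linearCombination_apply, Finsupp.sum, coeff_sum]
    simp only [coeff_smul, smul_eq_mul]
  have hexists : ∃ τ ∈ l.support, coeff α (b τ) ≠ 0 := by
    by_contra! hzero
    refine mem_support_iff.mp hα.1 ?_
    rw [hcoeff]
    exact Finset.sum_eq_zero fun τ hτ ↦ by rw [hzero τ hτ, mul_zero]
  obtain ⟨τ₁, hτ₁, hτ₁α⟩ := hexists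
  obtain ⟨τ, hτ, hmin⟩ := l.support.exists_min_image m.toSyn ⟨τ₁, hτ₁⟩
  have hτα : m.toSyn τ ≤ m.toSyn α :=
    (hmin τ₁ hτ₁).trans ((hb τ₁ (hl hτ₁)).2 α (mem_support_iff.mpr hτ₁α))
  have hcoeffτ : coeff τ (Finsupp.linearCombination k b l) = l τ := by
    rw [hcoeff, Finset.sum_eq_single_of_mem τ hτ, (hb τ (hl hτ)).1, mul_one]
    intro σ hσ hne
    by_contra hnz
    have hle := (hb σ (hl hσ)).2 τ (mem_support_iff.mpr (right_ne_zero_of_mul hnz))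
    exact hne (m.toSyn.injective (hle.antisymm (hmin σ hσ)))
  have hατ : m.toSyn α ≤ m.toSyn τ := by
    refine hα.2 τ (mem_support_iff.mpr ?_)
    rw [hcoeffτ]
    exact Finsupp.mem_support_iff.mp hτ
  rw [m.toSyn.injective (hατ.antisymm hτα)]
  exact hl hτ

/-- Buchberger's criterion in a single degree: if the `g c` capture all local leads in degrees
below `e`, and all generators and all joins of elements of `S` have degree below `e`,
then the `g c` capture all local leads in degree `e`. -/
theorem exists_le_of_isLocalLead_of_sup_lt {m : MonomialOrder (Fin n)}
    {S : Set (Fin n →₀ ℕ)} {g : (Fin n →₀ ℕ) → MvPolynomial (Fin n) k}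
    {ι : Type*} [Fintype ι] {f : ι → MvPolynomial (Fin n) k}
    {δ : ι → ℕ} (hf : ∀ i, (f i).IsHomogeneous (δ i))
    (hgI : ∀ c ∈ S, g c ∈ Ideal.span (Set.range f))
    (hghom : ∀ c ∈ S, (g c).IsHomogeneous (Finsupp.degree c))
    (hglead : ∀ c ∈ S, isMonicLocalLead m (g c) c) {e : ℕ} (hδ : ∀ i, δ i < e)
    (hcover : ∀ e' < e, ∀ h ∈ Ideal.span (Set.range f), h.IsHomogeneous e' →
      ∀ α, isLocalLead m h α → ∃ c ∈ S, c ≤ α)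
    (hsup : ∀ a ∈ S, ∀ b ∈ S, Finsupp.degree (a ⊔ b) < e)
    {h : MvPolynomial (Fin n) k} (hI : h ∈ Ideal.span (Set.range f)) (hhom : h.IsHomogeneous e)
    {α : Fin n →₀ ℕ} (hα : isLocalLead m h α) : ∃ c ∈ S, c ≤ α := by
  have hspan := mem_span_monomialMultiples_of_generators (g := g) (S := S) hf (fun i ↦
    mem_span_monomialMultiples hgI hghom hglead (hcover _ (hδ i))
      (Ideal.subset_span ⟨i, rfl⟩) (hf i) fun _ _ _ _ ↦ Set.mem_univ _) hI hhom
  let M : Set (Fin n →₀ ℕ) := {α | ∃ c ∈ S, c ≤ α}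
  have hM : ∀ α : Fin n →₀ ℕ, ∃ c, α ∈ M → c ∈ S ∧ c ≤ α := by
    intro α
    by_cases hα : α ∈ M
    · exact hα.imp fun c hc _ ↦ hc
    · exact ⟨0, fun h ↦ absurd h hα⟩
  choose pick hpick using hM
  let b : (Fin n →₀ ℕ) → MvPolynomial (Fin n) k := fun α ↦ monomial (α - pick α) 1 * g (pick α)
  have hb : ∀ α ∈ M, isMonicLocalLead m (b α) α := by
    intro α hα
    have := (hglead _ (hpick α hα).1).monomial_mul (α - pick α)
    rwa [tsub_add_cancel_of_le (hpick α hα).2] at this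
  refine isLocalLead.mem_of_mem_span hb ?_ hα
  refine (Submodule.span_le.mpr ?_) hspan
  rintro _ ⟨γ, c, hc, hdeg, -, rfl⟩
  -- all monomial multiples with the same exponent agree modulo those with larger exponents
  refine descending_induction m e (P := fun α ↦ ∀ γ, ∀ c ∈ S, γ + c = α →
    monomial γ 1 * g c ∈ Submodule.span k (b '' M)) ?_ (γ + c) hdeg γ c hc rfl
  clear! γ c α h
  rintro α hαe ih γ c hc rfl
  set α := γ + c
  have hαM : α ∈ M := ⟨c, hc, le_add_self⟩
  obtain ⟨hc', hc'le⟩ := hpick α hαM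
  set c' := pick α with hc'def
  set τ := c ⊔ c'
  have hτα : τ ≤ α := sup_le le_add_self hc'le
  have hcτ : τ - c + c = τ := tsub_add_cancel_of_le le_sup_left
  have hc'τ : τ - c' + c' = τ := tsub_add_cancel_of_le le_sup_right
  have hατ : α - τ + τ = α := tsub_add_cancel_of_le hτα
  let s : MvPolynomial (Fin n) k := monomial (τ - c) 1 * g c - monomial (τ - c') 1 * g c'
  have hsI : s ∈ Ideal.span (Set.range f) :=
    Ideal.sub_mem _ (Ideal.mul_mem_left _ _ (hgI c hc)) (Ideal.mul_mem_left _ _ (hgI c' hc'))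
  have hshom : s.IsHomogeneous (Finsupp.degree τ) := by
    have h₁ := (isHomogeneous_monomial (1 : k) (rfl : Finsupp.degree (τ - c) = _)).mul (hghom c hc)
    have h₂ := (isHomogeneous_monomial (1 : k) (rfl : Finsupp.degree (τ - c') = _)).mul
      (hghom c' hc')
    rw [← map_add, hcτ] at h₁
    rw [← map_add, hc'τ] at h₂
    exact h₁.sub h₂
  have hslt : ∀ β ∈ s.support, m.toSyn τ < m.toSyn β := by
    have h₁ := (hglead c hc).monomial_mul (τ - c)
    have h₂ := (hglead c' hc').monomial_mul (τ - c')
    rw [hcτ] at h₁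
    rw [hc'τ] at h₂
    have := h₂.lt_of_mem_support_sub h₁.2
    rwa [h₁.1, C_1, one_mul] at this
  have hsspan := mem_span_monomialMultiples (A := {β | m.toSyn τ < m.toSyn β}) hgI hghom hglead
    (hcover _ (hsup c hc c' hc')) hsI hshom fun β hβ γ hγ ↦ (hslt β hβ).trans_le hγ
  have hlift := monomial_mul_mem_span_monomialMultiples (B := {β | m.toSyn α < m.toSyn β}) hsspan
    (α - τ) 1 fun β hβ ↦ by
      rw [Set.mem_ofPred_eq, ← hατ, map_add, map_add, hατ]
      exact add_lt_add_right hβ _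
  have hle : Submodule.span k (monomialMultiples S g (Finsupp.degree (α - τ) + Finsupp.degree τ)
      {β | m.toSyn α < m.toSyn β}) ≤ Submodule.span k (b '' M) := by
    rw [← map_add, hατ, hαe, Submodule.span_le]
    rintro _ ⟨γ', c₁, hc₁, hdeg, hlt, rfl⟩
    exact ih (γ' + c₁) hdeg hlt γ' c₁ hc₁ rfl
  have heq : monomial γ 1 * g c = monomial (α - τ) 1 * s + b α := by
    have h₁ : α - τ + (τ - c) = γ := by
      apply add_right_cancel (b := c)
      rw [add_assoc, hcτ, hατ]
    have h₂ : α - τ + (τ - c') = α - c' := by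
      apply add_right_cancel (b := c')
      rw [add_assoc, hc'τ, hατ, tsub_add_cancel_of_le hc'le]
    simp only [s, b, mul_sub, ← mul_assoc, monomial_mul, mul_one, h₁, h₂, ← hc'def]
    rw [sub_add_cancel]
  rw [heq]
  exact add_mem (hle hlift) (Submodule.subset_span ⟨α, hαM, rfl⟩)

theorem memInitial.exists_isGCorner_le {m : MonomialOrder (Fin n)}
    {I : Ideal (MvPolynomial (Fin n) k)} {α : Fin n →₀ ℕ} (hα : memInitial m I α) :
    ∃ c, isGCorner m I c ∧ c ≤ α := by
  obtain ⟨c, ⟨hc, hle⟩, hmin⟩ := (wellFounded_lt (α := Fin n →₀ ℕ)).has_min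
    {c | memInitial m I c ∧ c ≤ α} ⟨α, hα, le_rfl⟩
  refine ⟨c, ⟨hc, fun ν hν hνc ↦ ?_⟩, hle⟩
  by_contra hne
  exact hmin ν ⟨hν, hνc.trans hle⟩ (lt_of_le_of_ne hνc hne)

section

attribute [local instance] MvPolynomial.gradedAlgebra

theorem homogeneousComponent_mem_span_range {ι : Type*} {f : ι → MvPolynomial (Fin n) k}
    (hf : ∀ i, ∃ e, (f i).IsHomogeneous e) {p : MvPolynomial (Fin n) k}
    (hp : p ∈ Ideal.span (Set.range f)) (e : ℕ) :
    homogeneousComponent e p ∈ Ideal.span (Set.range f) := by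
  have hhom : (Ideal.span (Set.range f)).IsHomogeneous (homogeneousSubmodule (Fin n) k) := by
    refine Ideal.homogeneous_span _ _ ?_
    rintro _ ⟨i, rfl⟩
    exact (hf i).imp fun e he ↦ (mem_homogeneousSubmodule _ _).mpr he
  exact decomposition.decompose'_apply p e ▸ hhom e hp

end

/-- A g-corner of a homogeneous ideal is the monic local lead of a homogeneous element. -/
theorem isGCorner.exists_isMonicLocalLead {m : MonomialOrder (Fin n)} {ι : Type*}
    {f : ι → MvPolynomial (Fin n) k} (hf : ∀ i, ∃ e, (f i).IsHomogeneous e) {c : Fin n →₀ ℕ}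
    (hc : isGCorner m (Ideal.span (Set.range f)) c) :
    ∃ g ∈ Ideal.span (Set.range f), g.IsHomogeneous (Finsupp.degree c) ∧
      isMonicLocalLead m g c := by
  obtain ⟨p, hp, hp0, β, hβ, hβc⟩ := hc.1
  obtain rfl := hc.2 β ⟨p, hp, hp0, β, hβ, le_rfl⟩ hβc
  have hcoeff := mem_support_iff.mp hβ.1
  refine ⟨C (coeff β p)⁻¹ * homogeneousComponent (Finsupp.degree β) p,
    Ideal.mul_mem_left _ _ (homogeneousComponent_mem_span_range hf hp _),
    (homogeneousComponent_isHomogeneous _ _).C_mul _, ?_, fun γ hγ ↦ hβ.2 γ ?_⟩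
  · rw [coeff_C_mul, coeff_homogeneousComponent, if_pos rfl, inv_mul_cancel₀ hcoeff]
  · rw [mem_support_iff, coeff_C_mul, coeff_homogeneousComponent] at hγ
    have := right_ne_zero_of_mul hγ
    split_ifs at this
    · exact mem_support_iff.mpr this
    · exact absurd rfl this

end StoppingCriterion

/-- stopping criterion for homogeneous ideals: if `I` is generated by nonzero
homogeneous polynomials of total degree at most `d` and some g-corner of `I` has total degree
exceeding `d`, then there is a g-corner `μ` with `d < |μ| ≤ max_{a,b ∈ C} |a ⊔ b| ≤ 2d`,
where `C` is the set of g-corners of total degree at most `d`. -/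
theorem stmt7 {k : Type*} [Field k] {n : ℕ} (hn : 1 ≤ n) (m : MonomialOrder (Fin n))
    (hm : ∀ α β : Fin n →₀ ℕ, Finsupp.degree α < Finsupp.degree β → m.toSyn α < m.toSyn β)
    (d : ℕ) (r : ℕ) (f : Fin r → MvPolynomial (Fin n) k)
    (hne : ∀ i, f i ≠ 0)
    (hhom : ∀ i, ∃ e : ℕ, (f i).IsHomogeneous e)
    (hdeg : ∀ i, (f i).totalDegree ≤ d)
    (I : Ideal (MvPolynomial (Fin n) k)) (hI : I = Ideal.span (Set.range f))
    (C : Set (Fin n →₀ ℕ)) (hC : C = {μ | isGCorner m I μ ∧ Finsupp.degree μ ≤ d})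
    (hbig : ∃ μ, isGCorner m I μ ∧ d < Finsupp.degree μ) :
    ∃ μ, isGCorner m I μ ∧ d < Finsupp.degree μ ∧
      (∃ a ∈ C, ∃ b ∈ C, Finsupp.degree μ ≤ Finsupp.degree (a ⊔ b)) ∧
      Finsupp.degree μ ≤ 2 * d := by
  subst hI hC
  set I := Ideal.span (Set.range f)
  suffices ∃ μ, isGCorner m I μ ∧ d < Finsupp.degree μ ∧
      ∃ a ∈ {μ | isGCorner m I μ ∧ Finsupp.degree μ ≤ d},
        ∃ b ∈ {μ | isGCorner m I μ ∧ Finsupp.degree μ ≤ d},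
          Finsupp.degree μ ≤ Finsupp.degree (a ⊔ b) by
    obtain ⟨μ, hμ, hdμ, a, ha, b, hb, hle⟩ := this
    refine ⟨μ, hμ, hdμ, ⟨a, ha, b, hb, hle⟩, hle.trans ?_⟩
    have hsup : Finsupp.degree (a ⊔ b) ≤ Finsupp.degree (a + b) :=
      Finsupp.degree_mono (sup_le le_self_add le_add_self)
    rw [map_add] at hsup
    have := ha.2
    have := hb.2
    omega
  obtain ⟨μ, ⟨hμ, hdμ⟩, hmin⟩ := (measure (Finsupp.degree : (Fin n →₀ ℕ) → ℕ)).wf.has_min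
    {μ | isGCorner m I μ ∧ d < Finsupp.degree μ} hbig
  refine ⟨μ, hμ, hdμ, ?_⟩
  by_contra! hsup
  choose δ hδ using hhom
  have hcorner (c : Fin n →₀ ℕ) : ∃ g : MvPolynomial (Fin n) k, isGCorner m I c →
      g ∈ I ∧ g.IsHomogeneous (Finsupp.degree c) ∧ isMonicLocalLead m g c := by
    by_cases hc : isGCorner m I c
    · exact (hc.exists_isMonicLocalLead fun i ↦ ⟨δ i, hδ i⟩).imp fun g hg _ ↦ hg
    · exact ⟨0, fun h ↦ absurd h hc⟩
  choose g hg using hcorner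
  obtain ⟨hgμ, hgμhom, hgμlead⟩ := hg μ hμ
  obtain ⟨c, ⟨hc, hcd⟩, hcμ⟩ := exists_le_of_isLocalLead_of_sup_lt (m := m) (g := g) hδ
    (fun c hc ↦ (hg c hc.1).1) (fun c hc ↦ (hg c hc.1).2.1) (fun c hc ↦ (hg c hc.1).2.2)
    (fun i ↦ ((hδ i).totalDegree (hne i) ▸ hdeg i).trans_lt hdμ)
    (by
      intro e he h hhI hhom α hα
      have h0 : h ≠ 0 := support_nonempty.mp ⟨α, hα.1⟩
      obtain ⟨c, hc, hcα⟩ :=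
        memInitial.exists_isGCorner_le (m := m) ⟨h, hhI, h0, α, hα, le_rfl⟩
      refine ⟨c, ⟨hc, ?_⟩, hcα⟩
      by_contra! hcd
      refine hmin c ⟨hc, hcd⟩ ((Finsupp.degree_mono hcα).trans_lt ?_)
      rwa [hhom.degree_eq_of_mem_support hα.1])
    hsup hgμ hgμhom
    (α := μ) ⟨mem_support_iff.mpr (by rw [hgμlead.1]; exact one_ne_zero), hgμlead.2⟩
  rw [hμ.2 c hc.1 hcμ] at hcd
  omega
end

section
/- (Inclusion–exclusion formula for the Hilbert function of a monomial ideal.) Let n ≥ 1, let r ∈ ℕ, and let m : Fin r → (Fin n →₀ ℕ) be a family of exponent vectors. For every d ∈ ℕ, the number of exponent vectors α with |α| = d such that for no i does m(i) ≤ α componentwise, taken as an integer, equals the sum over all subsets S of Fin r of (−1)^|S| · c(S, d), where c(S, d) = choose(d − |⊔_{i∈S} m(i)| + n − 1, n − 1) if |⊔_{i∈S} m(i)| ≤ d and c(S, d) = 0 otherwise; here ⊔_{i∈S} m(i) is the componentwise maximum (the exponent of the least common multiple) and |·| is the sum of entries. -/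
/-- The exponents of degree `d` in `n` variables, counted by stars and bars. -/
lemma card_finsuppAntidiag_univ_fin (n : ℕ) (hn : 1 ≤ n) (d : ℕ) :
    ((Finset.univ : Finset (Fin n)).finsuppAntidiag d).card = (d + n - 1).choose (n - 1) := by
  rw [Finset.card_finsuppAntidiag_nat_eq_choose, Finset.card_univ, Fintype.card_fin, add_comm n d]
  exact Nat.choose_symm_of_eq_add (by lia)

lemma mem_finsuppAntidiag_univ_iff_degree {n d : ℕ} (α : Fin n →₀ ℕ) :
    α ∈ (Finset.univ : Finset (Fin n)).finsuppAntidiag d ↔ Finsupp.degree α = d := by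
  simp [Finset.mem_finsuppAntidiag, Finsupp.degree_eq_sum]

/-- The number of multiples of `x^μ` of degree `d`. -/
lemma card_finsuppAntidiag_filter_le (n : ℕ) (hn : 1 ≤ n) (μ : Fin n →₀ ℕ) (d : ℕ) :
    {α ∈ (Finset.univ : Finset (Fin n)).finsuppAntidiag d | μ ≤ α}.card =
      if Finsupp.degree μ ≤ d then (d - Finsupp.degree μ + n - 1).choose (n - 1) else 0 := by
  split_ifs with h
  · rw [← card_finsuppAntidiag_univ_fin n hn]
    symm
    refine Finset.card_nbij' (fun β ↦ β + μ) (fun α ↦ α - μ) ?_ ?_ ?_ ?_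
    · intro β hβ
      simp only [Finset.mem_coe, Finset.mem_filter, mem_finsuppAntidiag_univ_iff_degree,
        map_add] at hβ ⊢
      exact ⟨by lia, le_add_self⟩
    · intro α hα
      simp only [Finset.mem_coe, Finset.mem_filter, mem_finsuppAntidiag_univ_iff_degree] at hα ⊢
      have := congrArg Finsupp.degree (tsub_add_cancel_of_le hα.2)
      rw [map_add] at this
      lia
    · intro β _
      exact add_tsub_cancel_right β μ
    · intro α hα
      exact tsub_add_cancel_of_le (Finset.mem_filter.1 hα).2
  · rw [Finset.card_eq_zero, Finset.filter_eq_empty_iff]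
    intro α hα hμ
    rw [mem_finsuppAntidiag_univ_iff_degree] at hα
    have := congrArg Finsupp.degree (tsub_add_cancel_of_le hμ)
    rw [map_add] at this
    lia

/-- Inclusion–exclusion for the elements lying above no member of a finite family. -/
lemma card_filter_forall_not_le_eq_sum {ι P : Type*} [Fintype ι] [SemilatticeSup P] [OrderBot P]
    [DecidableLE P] (A : Finset P) (m : ι → P) [DecidablePred fun α ↦ ∀ i, ¬ m i ≤ α] :
    ({α ∈ A | ∀ i, ¬ m i ≤ α}.card : ℤ) =
      ∑ S : Finset ι, (-1 : ℤ) ^ S.card * ({α ∈ A | S.sup m ≤ α}.card : ℤ) := by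
  classical
  simp only [Finset.natCast_card_filter, Finset.mul_sum]
  rw [Finset.sum_comm]
  refine Finset.sum_congr rfl fun α _ ↦ ?_
  have key := Finset.sum_powerset_neg_one_pow_card (x := {i | m i ≤ α})
  have hpow : ({i | m i ≤ α} : Finset ι).powerset =
      ({S | S.sup m ≤ α} : Finset (Finset ι)) := by
    ext S
    simp [Finset.subset_iff]
  rw [hpow, Finset.sum_filter] at key
  simp only [mul_ite, mul_one, mul_zero, key, Finset.filter_eq_empty_iff, Finset.mem_univ,
    true_imp_iff]


/-- inclusion–exclusion formula for the Hilbert function of a monomial ideal: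
the number of exponents `α` of total degree `d` divisible by no `m i` equals
`∑_{S ⊆ Fin r} (−1)^|S| · choose(d − |⊔_{i∈S} m i| + n − 1, n − 1)`, where the binomial term
is taken to be `0` when `|⊔_{i∈S} m i| > d`. -/
theorem stmt17 (n : ℕ) (hn : 1 ≤ n) (r : ℕ) (m : Fin r → (Fin n →₀ ℕ)) (d : ℕ) :
    ({α : Fin n →₀ ℕ | Finsupp.degree α = d ∧ ∀ i, ¬ m i ≤ α}.ncard : ℤ) =
      ∑ S : Finset (Fin r), (-1 : ℤ) ^ S.card *
        (if Finsupp.degree (S.sup m) ≤ d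
          then ((d - Finsupp.degree (S.sup m) + n - 1).choose (n - 1) : ℤ)
          else 0) := by
  have hset : {α : Fin n →₀ ℕ | Finsupp.degree α = d ∧ ∀ i, ¬ m i ≤ α} =
      ({α ∈ (Finset.univ : Finset (Fin n)).finsuppAntidiag d | ∀ i, ¬ m i ≤ α} :
        Finset (Fin n →₀ ℕ)) := by
    ext α
    simp only [Set.mem_ofPred_eq, Finset.mem_coe, Finset.mem_filter,
      mem_finsuppAntidiag_univ_iff_degree]
  rw [hset, Set.ncard_coe_finset, card_filter_forall_not_le_eq_sum]
  refine Finset.sum_congr rfl fun S _ ↦ ?_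
  rw [card_finsuppAntidiag_filter_le n hn]
  push_cast
  rfl
end
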